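/- arXiv:2205.12621 — 4 statements merged into one kernel-verified Lean document; each statement's English description precedes it below -/
import Mathlib

section
/- For every integer n ≥ 1, the number of spanning trees on n words, i.e. the number of parent assignments t : Fin n → Fin (n+1) whose functional graph is acyclic (from every word node, repeatedly following heads eventually reaches the ROOT node 0), equals (n+1)^(n−1). (Cayley's formula with an offset of 1 to account for the artificial ROOT node: |T| = C_n = (n+1)^(n−1).) -/
open Finset
open scoped Classical

noncomputable section

/-- One step of following head pointers: ROOT (node 0) maps to itself,
word node `i+1` maps to its head `t i`. -/
def step {n : ℕ} (t : Fin n → Fin (n + 1)) : Fin (n + 1) → Fin (n + 1) :=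
  Fin.cases 0 (fun i => t i)

/-- A parent assignment is a spanning tree iff from every node, repeatedly
following heads eventually reaches the ROOT node 0. -/
def IsSpanningTree {n : ℕ} (t : Fin n → Fin (n + 1)) : Prop :=
  ∀ v : Fin (n + 1), ∃ k : ℕ, (step t)^[k] v = 0

/-- A dependency tree is a spanning tree where exactly one word has head ROOT. -/
def IsDepTree {n : ℕ} (t : Fin n → Fin (n + 1)) : Prop :=
  IsSpanningTree t ∧ ∃! i : Fin n, t i = 0

/-- Weight of a tree: product of weights of its edges, `φ j i` is the weight
of the edge from head node `j` to word node `i`. -/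
def treeWeight {n : ℕ} (φ : Fin (n + 1) → Fin n → ℝ) (t : Fin n → Fin (n + 1)) : ℝ :=
  ∏ i : Fin n, φ (t i) i

/-- Partition function over spanning trees. -/
def ZT {n : ℕ} (φ : Fin (n + 1) → Fin n → ℝ) : ℝ :=
  ∑ t ∈ univ.filter (fun t : Fin n → Fin (n + 1) => IsSpanningTree t), treeWeight φ t

/-- Partition function over single-root dependency trees. -/
def ZD {n : ℕ} (φ : Fin (n + 1) → Fin n → ℝ) : ℝ :=
  ∑ t ∈ univ.filter (fun t : Fin n → Fin (n + 1) => IsDepTree t), treeWeight φ t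

/-- Total weight of dependency trees whose root word is `r` (root edge ROOT → r). -/
def rootMass {n : ℕ} (φ : Fin (n + 1) → Fin n → ℝ) (r : Fin n) : ℝ :=
  ∑ t ∈ univ.filter (fun t : Fin n → Fin (n + 1) => IsDepTree t ∧ t r = 0), treeWeight φ t


/-- `Grounded t v` says that following `t` from `v` eventually reaches a root in `R`. -/
inductive Grounded {V R : Type*} (t : V → V ⊕ R) : V → Prop
  | root {v : V} {r : R} (h : t v = Sum.inr r) : Grounded t v
  | step {v w : V} (h : t v = Sum.inl w) (hw : Grounded t w) : Grounded t v

/-- Rooted forests on `V` whose trees are attached to the roots `R`. -/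
abbrev Forest (V R : Type*) : Type _ := {t : V → V ⊕ R // ∀ v, Grounded t v}

theorem Grounded.nonempty_root {V R : Type*} {t : V → V ⊕ R} {v : V} (h : Grounded t v) :
    Nonempty R := by
  induction h with
  | @root v r _ => exact ⟨r⟩
  | step _ _ ih => exact ih

/-- The head assignment in which `S` is the set of children of the roots, with heads `g`, and the
other nodes have heads `u`. -/
def glue {V R : Type*} (S : Finset V) (g : S → R)
    (u : {v // v ∉ S} → {v // v ∉ S} ⊕ S) : V → V ⊕ R :=
  fun v => if h : v ∈ S then Sum.inr (g ⟨v, h⟩)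
    else Sum.inl (Sum.elim Subtype.val Subtype.val (u ⟨v, h⟩))

section glue

variable {V R : Type*} {S : Finset V} {g : S → R} {u : {v // v ∉ S} → {v // v ∉ S} ⊕ S}

theorem glue_of_mem {v : V} (h : v ∈ S) : glue S g u v = Sum.inr (g ⟨v, h⟩) := by
  simp [glue, h]

theorem glue_of_notMem {v : V} (h : v ∉ S) :
    glue S g u v = Sum.inl (Sum.elim Subtype.val Subtype.val (u ⟨v, h⟩)) := by
  simp [glue, h]

theorem mem_iff_isRight_glue (v : V) : v ∈ S ↔ (glue S g u v).isRight := by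
  by_cases h : v ∈ S
  · simp [glue_of_mem h, h]
  · simp [glue_of_notMem h, h]

theorem Grounded.glue {v : {v // v ∉ S}} (h : Grounded u v) :
    Grounded (glue S g u) (v : V) := by
  induction h with
  | @root v s h => exact .step (by rw [glue_of_notMem v.2, h]; rfl) (.root (glue_of_mem s.2))
  | @step v w h _ ih => exact .step (by rw [glue_of_notMem v.2, h]; rfl) ih

theorem Grounded.of_glue {v : V} (h : Grounded (_root_.glue S g u) v) (hv : v ∉ S) :
    Grounded u ⟨v, hv⟩ := by
  induction h with
  | root h => simp [glue_of_notMem hv] at h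
  | @step v w h _ ih =>
    rw [glue_of_notMem hv] at h
    rcases hu : u ⟨v, hv⟩ with x | s
    · obtain rfl : (x : V) = w := by simpa [hu] using h
      exact .step hu (ih x.2)
    · exact .root hu

theorem forall_grounded_glue_iff :
    (∀ v, Grounded (glue S g u) v) ↔ ∀ v, Grounded u v := by
  refine ⟨fun h v => (h v).of_glue v.2, fun h v => ?_⟩
  by_cases hv : v ∈ S
  · exact .root (glue_of_mem hv)
  · exact (h ⟨v, hv⟩).glue

end glue

theorem sumElim_val_injective {V : Type*} (S : Finset V) :
    Function.Injective
      (Sum.elim Subtype.val Subtype.val : {v // v ∉ S} ⊕ S → V) :=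
  Subtype.val_injective.sumElim Subtype.val_injective fun a b h => a.2 (h ▸ b.2)

/-- Assemble a forest from the set of children of the roots, their heads, and the forest of the
remaining nodes rooted at that set. -/
def glueForest (V R : Type*) :
    (Σ S : Finset V, (S → R) × Forest {v // v ∉ S} S) → Forest V R :=
  fun x => ⟨glue x.1 x.2.1 x.2.2.1, forall_grounded_glue_iff.2 x.2.2.2⟩

theorem glueForest_injective (V R : Type*) : Function.Injective (glueForest V R) := by
  rintro ⟨S, g, u, hu⟩ ⟨S', g', u', hu'⟩ h
  have h : glue S g u = glue S' g' u' := congrArg Subtype.val h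
  obtain rfl : S = S' := by
    ext v
    rw [mem_iff_isRight_glue (g := g) (u := u), h, ← mem_iff_isRight_glue]
  obtain rfl : g = g' := by
    ext ⟨v, hv⟩
    simpa [glue_of_mem hv] using congrFun h v
  obtain rfl : u = u' := by
    ext1 ⟨v, hv⟩
    apply sumElim_val_injective S
    have := congrFun h v
    rw [glue_of_notMem hv, glue_of_notMem hv] at this
    exact Sum.inl_injective this
  rfl

theorem glueForest_surjective (V R : Type*) [Fintype V] :
    Function.Surjective (glueForest V R) := by
  rintro ⟨t, ht⟩
  let S : Finset V := univ.filter fun v => (t v).isRight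
  have hS (v : V) : v ∈ S ↔ (t v).isRight := by simp [S]
  have hg (s : S) : ∃ r, t s = Sum.inr r := Sum.isRight_iff.1 ((hS s).1 s.2)
  have hu (v : {v // v ∉ S}) : ∃ x : {v // v ∉ S} ⊕ S,
      t v = Sum.inl (Sum.elim Subtype.val Subtype.val x) := by
    rcases h : t v with w | r
    · by_cases hw : w ∈ S
      · exact ⟨Sum.inr ⟨w, hw⟩, rfl⟩
      · exact ⟨Sum.inl ⟨w, hw⟩, rfl⟩
    · exact absurd ((hS v).2 (by simp [h])) v.2
  choose g hg using hg
  choose u hu using hu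
  have hglue : glue S g u = t := by
    ext1 v
    by_cases h : v ∈ S
    · rw [glue_of_mem h, hg ⟨v, h⟩]
    · rw [glue_of_notMem h, hu ⟨v, h⟩]
  exact ⟨⟨S, g, u, forall_grounded_glue_iff.1 (hglue ▸ ht)⟩, Subtype.ext hglue⟩

/-- The number of forests on `n` nodes attached to `r` roots. -/
def forestCount (n r : ℕ) : ℕ := if n = 0 then 1 else r * (r + n) ^ (n - 1)

theorem choose_mul_forestCount {m k : ℕ} (hk : k ≤ m) :
    (m + 1).choose (k + 1) * forestCount (m - k) (k + 1) = m.choose k * (m + 1) ^ (m - k) := by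
  obtain ⟨d, rfl⟩ := Nat.exists_eq_add_of_le hk
  have h := Nat.add_one_mul_choose_eq (k + d) k
  rcases d with _ | d
  · simp [forestCount]
  · have e : k + 1 + (d + 1) = k + (d + 1) + 1 := by ring
    simp only [forestCount, Nat.add_sub_cancel_left, Nat.add_sub_cancel, Nat.succ_ne_zero,
      if_false, e]
    rw [← mul_assoc, ← h, pow_succ]
    ring

theorem sum_choose_mul_forestCount (m r : ℕ) :
    ∑ s ∈ range (m + 2), (m + 1).choose s * (r ^ s * forestCount (m + 1 - s) s) =
      forestCount (m + 1) r := by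
  rw [sum_range_succ']
  have h : ∀ k ∈ range (m + 1),
      (m + 1).choose (k + 1) * (r ^ (k + 1) * forestCount (m + 1 - (k + 1)) (k + 1)) =
        r * (r ^ k * (m + 1) ^ (m - k) * m.choose k) := by
    intro k hk
    rw [Nat.add_sub_add_right, mul_left_comm,
      choose_mul_forestCount (Nat.lt_succ_iff.1 (mem_range.1 hk)), pow_succ]
    ring
  have hadd : ∑ k ∈ range (m + 1), r ^ k * (m + 1) ^ (m - k) * m.choose k = (r + (m + 1)) ^ m := by
    simpa using (add_pow r (m + 1) m).symm
  rw [sum_congr rfl h, ← mul_sum, hadd]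
  simp [forestCount]

/-- The number of forests on `V` attached to the roots `R`. -/
theorem card_forest.{u} (V R : Type u) [Finite V] [Finite R] :
    Nat.card (Forest V R) = forestCount (Nat.card V) (Nat.card R) := by
  induction hn : Nat.card V using Nat.strong_induction_on generalizing V R with
  | _ n ih =>
  rcases n with _ | m
  · have : IsEmpty V := (Nat.card_eq_zero.1 hn).resolve_right (not_infinite_iff_finite.2 ‹_›)
    have : Unique (Forest V R) :=
      { default := ⟨isEmptyElim, isEmptyElim⟩
        uniq := fun t => Subtype.ext (Subsingleton.elim _ _) }
    simp [forestCount]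
  have := Fintype.ofFinite V
  obtain ⟨v⟩ : Nonempty V := (Nat.card_pos_iff.1 (by lia)).1
  have hV : Fintype.card V = m + 1 := by rw [← Nat.card_eq_fintype_card, hn]
  have hS (S : Finset V) : Nat.card S = #S := by rw [Nat.card_eq_fintype_card, Fintype.card_coe]
  have hcard (S : Finset V) :
      Nat.card (Forest {v // v ∉ S} S) = forestCount (m + 1 - #S) #S := by
    rcases S.eq_empty_or_nonempty with rfl | hne
    · have : IsEmpty (Forest {v // v ∉ (∅ : Finset V)} (∅ : Finset V)) :=
        ⟨fun t => (t.2 ⟨v, notMem_empty v⟩).nonempty_root.elim fun s => notMem_empty _ s.2⟩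
      rw [Nat.card_of_isEmpty]
      simp [forestCount]
    · have hc : Nat.card {v // v ∉ S} = m + 1 - #S := by
        rw [Nat.card_eq_fintype_card, Fintype.card_subtype_compl, hV, Fintype.card_coe]
      have := hne.card_pos
      rw [ih (m + 1 - #S) (by lia) _ _ hc, hS]
  rw [← Nat.card_congr (Equiv.ofBijective _ ⟨glueForest_injective V R, glueForest_surjective V R⟩),
    Nat.card_sigma, ← sum_choose_mul_forestCount, ← powerset_univ]
  simp only [Nat.card_prod, Nat.card_fun, hcard, hS]
  rw [sum_powerset_apply_card (fun s => Nat.card R ^ s * forestCount (m + 1 - s) s)]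
  simp [hV]

/-- The nodes of a parent assignment, with the words separated from the ROOT node. -/
def nodeEquiv (n : ℕ) : Fin n ⊕ Unit ≃ Fin (n + 1) :=
  (Equiv.optionEquivSumPUnit (Fin n)).symm.trans (finSuccEquiv n).symm

theorem nodeEquiv_inl {n : ℕ} (i : Fin n) : nodeEquiv n (Sum.inl i) = i.succ := by
  simp [nodeEquiv]

theorem nodeEquiv_inr {n : ℕ} (x : Unit) : nodeEquiv n (Sum.inr x) = 0 := by
  simp [nodeEquiv]

theorem forall_grounded_iff_isSpanningTree {n : ℕ} (t : Fin n → Fin n ⊕ Unit) :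
    (∀ v, Grounded t v) ↔ IsSpanningTree fun i => nodeEquiv n (t i) := by
  have hstep (v : Fin n) : step (fun i => nodeEquiv n (t i)) v.succ = nodeEquiv n (t v) := rfl
  constructor
  · intro h v
    refine Fin.cases ⟨0, rfl⟩ (fun v => ?_) v
    induction h v with
    | root h => exact ⟨1, by rw [Function.iterate_one, hstep, h, nodeEquiv_inr]⟩
    | step h _ ih =>
      obtain ⟨k, hk⟩ := ih
      exact ⟨k + 1, by rw [Function.iterate_succ_apply, hstep, h, nodeEquiv_inl, hk]⟩
  · intro h v
    obtain ⟨k, hk⟩ := h v.succ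
    induction k generalizing v with
    | zero => exact absurd hk (Fin.succ_ne_zero v)
    | succ k ih =>
      rw [Function.iterate_succ_apply, hstep] at hk
      rcases ht : t v with w | r
      · rw [ht, nodeEquiv_inl] at hk
        exact .step ht (ih w hk)
      · exact .root ht

/-- **Cayley's formula with ROOT offset.** The number of spanning trees over `n` words
plus an artificial ROOT node, i.e. parent assignments `t : Fin n → Fin (n+1)` whose
functional graph is acyclic, is `|T| = (n+1)^(n−1)`. -/
theorem card_spanning_trees {n : ℕ} (hn : 1 ≤ n) :
    (univ.filter (fun t : Fin n → Fin (n + 1) => IsSpanningTree t)).card =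
      (n + 1) ^ (n - 1) := by
  have e : Forest (Fin n) Unit ≃ {t : Fin n → Fin (n + 1) // IsSpanningTree t} :=
    ((Equiv.refl (Fin n)).arrowCongr (nodeEquiv n)).subtypeEquiv
      forall_grounded_iff_isSpanningTree
  rw [← Fintype.card_subtype, ← Nat.card_eq_fintype_card, ← Nat.card_congr e, card_forest]
  simp [forestCount, Nat.one_le_iff_ne_zero.1 hn, add_comm]

end
end

section
/- For every integer n ≥ 1, the number of single-root dependency trees on n words, i.e. the number of parent assignments t : Fin n → Fin (n+1) whose functional graph is acyclic (from every word node, repeatedly following heads eventually reaches the ROOT node 0) and in which exactly one word has head 0, equals n^(n−1). (|D| = n · C_{n−1} = n^(n−1), since any of the n words can be picked as the root of the smaller sub-graph of n−1 words.) -/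
open Finset
open scoped Classical

noncomputable section

/-- Over an embedding `ι` of the non-root nodes `A` into all nodes `V`, the parent map `f` is
acyclic when its parent relation on `A` is well-founded. -/
def Acyclic {A V : Type} (ι f : A → V) : Prop :=
  WellFounded fun a' a => f a = ι a'

lemma wellFounded_iff_subtype {α : Type*} {R : α → α → Prop} {q : α → Prop}
    (h : ∀ a' a, R a' a → q a) :
    WellFounded R ↔ WellFounded fun x y : {a // q a} => R x y := by
  refine ⟨fun H => InvImage.wf Subtype.val H, fun H => ?_⟩
  have acc_of : ∀ x : {a // q a}, Acc R x := fun x => by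
    induction x using H.induction with
    | _ x ih =>
      refine ⟨_, fun y hy => ?_⟩
      by_cases hq : q y
      · exact ih ⟨y, hq⟩ hy
      · exact ⟨_, fun z hz => absurd (h _ _ hz) hq⟩
  refine ⟨fun a => ⟨_, fun b hb => ?_⟩⟩
  exact (acc_of ⟨a, h _ _ hb⟩).inv hb

/-- An acyclic parent map whose set of root children is `K` is a pair of an arbitrary map from `K`
to the roots and an acyclic parent map with the elements of `K` as new roots. -/
lemma card_acyclic_fiber {A V : Type} [Finite A] {ι : A → V} (hι : ι.Injective)
    (K : Finset A) :
    Nat.card {f : A → V // Acyclic ι f ∧ ∀ a, f a ∈ Set.range ι ↔ a ∉ K} =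
      Nat.card {v // v ∉ Set.range ι} ^ #K *
        Nat.card {h : {a // a ∉ K} → A // Acyclic Subtype.val h} := by
  have acyclic_iff : ∀ (f : A → V) (h : {a // a ∉ K} → A),
      (∀ a, f a ∈ Set.range ι ↔ a ∉ K) → (∀ x, f x.1 = ι (h x)) →
      (Acyclic ι f ↔ Acyclic Subtype.val h) := by
    intro f h hq hf
    unfold Acyclic
    rw [wellFounded_iff_subtype (q := (· ∉ K)) fun a' a haa => (hq a).1 ⟨a', haa.symm⟩]
    simp only [hf, hι.eq_iff]
  let glue (x : ({a // a ∈ K} → {v // v ∉ Set.range ι}) ×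
      {h : {a // a ∉ K} → A // Acyclic Subtype.val h}) (a : A) : V :=
    if ha : a ∈ K then (x.1 ⟨a, ha⟩).1 else ι (x.2.1 ⟨a, ha⟩)
  have glue_mem : ∀ x a, glue x a ∈ Set.range ι ↔ a ∉ K := fun x a => by
    by_cases ha : a ∈ K
    · simpa [glue, ha] using (x.1 ⟨a, ha⟩).2
    · simp [glue, ha]
  have glue_acyclic : ∀ x, Acyclic ι (glue x) := fun x =>
    (acyclic_iff _ x.2.1 (glue_mem x) fun y => by simp [glue, y.2]).2 x.2.2
  have glue_bijective : Function.Bijective fun x =>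
      (⟨glue x, glue_acyclic x, glue_mem x⟩ :
        {f : A → V // Acyclic ι f ∧ ∀ a, f a ∈ Set.range ι ↔ a ∉ K}) := by
    constructor
    · rintro ⟨g, h, hh⟩ ⟨g', h', hh'⟩ heq
      have heq := congrFun (Subtype.ext_iff.1 heq)
      have hg : g = g' := funext fun a => Subtype.ext (by simpa [glue, a.2] using heq a)
      have hh : h = h' := funext fun a => hι (by simpa [glue, a.2] using heq a)
      subst hg hh
      rfl
    · rintro ⟨f, hf, hq⟩
      choose h hh using fun x : {a // a ∉ K} => (hq x).2 x.2
      refine ⟨⟨fun a => ⟨f a, fun H => (hq a).1 H a.2⟩, h,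
        (acyclic_iff f h hq fun x => (hh x).symm).1 hf⟩, Subtype.ext (funext fun a => ?_)⟩
      by_cases ha : a ∈ K
      · simp [glue, ha]
      · simp [glue, ha, hh]
  rw [← Nat.card_congr (Equiv.ofBijective _ glue_bijective), Nat.card_prod, Nat.card_fun,
    Nat.card_eq_fintype_card (α := {a // a ∈ K}), Fintype.card_coe]

lemma card_acyclic_eq_sum {A V : Type} [Fintype A] [Finite V] {ι : A → V}
    (hι : ι.Injective) :
    Nat.card {f : A → V // Acyclic ι f} =
      ∑ K : Finset A, Nat.card {v // v ∉ Set.range ι} ^ #K *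
        Nat.card {h : {a // a ∉ K} → A // Acyclic Subtype.val h} := by
  rw [← Nat.card_congr (Equiv.sigmaFiberEquiv fun f : {f : A → V // Acyclic ι f} =>
    univ.filter fun a => f.1 a ∉ Set.range ι), Nat.card_sigma]
  refine Finset.sum_congr rfl fun K _ => ?_
  rw [← card_acyclic_fiber hι K, ← Nat.card_congr (Equiv.subtypeSubtypeEquivSubtypeInter _ _)]
  refine Nat.card_congr (Equiv.subtypeEquivRight fun f => ?_)
  simp only [Finset.ext_iff, Finset.mem_filter, Finset.mem_univ, true_and]
  exact forall_congr' fun a => not_iff_comm.trans (iff_comm.trans (by tauto))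

lemma sum_card_mul_pow_mul_pow {A : Type*} [Fintype A] (x y : ℕ) :
    ∑ K : Finset A, x ^ #K * (#K * y ^ (Fintype.card A - #K)) =
      Fintype.card A * x * (x + y) ^ (Fintype.card A - 1) := by
  rw [← Finset.powerset_univ, Finset.sum_powerset_apply_card
    (fun k => x ^ k * (k * y ^ (Fintype.card A - k))), Finset.card_univ]
  cases Fintype.card A with
  | zero => simp
  | succ m =>
    rw [Finset.sum_range_succ', add_tsub_cancel_right, add_pow, Finset.mul_sum]
    simp only [zero_mul, mul_zero, add_zero, smul_eq_mul]
    refine Finset.sum_congr rfl fun k _ => ?_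
    rw [Nat.add_sub_add_right]
    calc _ = x ^ (k + 1) * y ^ (m - k) * ((m + 1).choose (k + 1) * (k + 1)) := by ring
      _ = _ := by rw [← Nat.add_one_mul_choose_eq, pow_succ, Nat.cast_id]; ring

/-- The number of rooted forests on `a + b` nodes with `b` prescribed roots is
`b * (a + b) ^ (a - 1)`. -/
theorem card_acyclic {A V : Type} [Finite A] [Finite V] {ι : A → V} (hι : ι.Injective) :
    Nat.card V * Nat.card {f : A → V // Acyclic ι f} =
      Nat.card {v // v ∉ Set.range ι} * Nat.card V ^ Nat.card A := by
  induction hn : Nat.card A using Nat.strong_induction_on generalizing A V with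
  | _ n ih =>
    subst hn
    have := Fintype.ofFinite A
    have card_V : Nat.card V = Nat.card {v // v ∉ Set.range ι} + Nat.card A := by
      rw [Nat.card_congr (Equiv.ofInjective ι hι), add_comm, ← Nat.card_sum]
      exact (Nat.card_congr (Equiv.sumCompl (· ∈ Set.range ι))).symm
    have card_new : ∀ K : Finset A, Nat.card A *
        Nat.card {h : {a // a ∉ K} → A // Acyclic Subtype.val h} =
          #K * Nat.card A ^ (Nat.card A - #K) := by
      intro K
      have card_compl : Nat.card {a // a ∉ K} = Nat.card A - #K := by
        simp [Nat.card_eq_fintype_card, Fintype.card_subtype_compl]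
      rcases K.eq_empty_or_nonempty with rfl | hK
      · cases isEmpty_or_nonempty A with
        | inl _ => simp
        | inr _ =>
          have : IsEmpty {h : {a // a ∉ (∅ : Finset A)} → A // Acyclic Subtype.val h} := by
            refine ⟨fun ⟨h, hh⟩ => ?_⟩
            obtain ⟨a, -, ha⟩ := hh.has_min Set.univ ⟨⟨Classical.arbitrary A, by simp⟩, trivial⟩
            exact ha ⟨h a, by simp⟩ trivial rfl
          simp
      · have hlt : Nat.card {a // a ∉ K} < Nat.card A := by
          have := hK.card_pos
          have := Finset.card_le_univ K
          rw [card_compl, Nat.card_eq_fintype_card]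
          omega
        have card_range :
            Nat.card {v // v ∉ Set.range (Subtype.val : {a // a ∉ K} → A)} = #K := by
          simp
        rw [ih _ hlt Subtype.val_injective rfl, card_range, card_compl]
    cases isEmpty_or_nonempty A with
    | inl _ =>
      have : Unique {f : A → V // Acyclic ι f} :=
        { default := ⟨isEmptyElim, ⟨isEmptyElim⟩⟩
          uniq := fun f => Subtype.ext (funext isEmptyElim) }
      rw [Nat.card_unique (α := {f : A → V // Acyclic ι f}), Nat.card_of_isEmpty (α := A), pow_zero,
        card_V, Nat.card_of_isEmpty (α := A), add_zero]
    | inr _ =>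
      refine Nat.eq_of_mul_eq_mul_left (Nat.card_pos (α := A)) ?_
      rw [card_acyclic_eq_sum hι, mul_left_comm, Finset.mul_sum,
        Finset.sum_congr rfl fun K _ => (mul_left_comm _ _ _).trans (congrArg _ (card_new K))]
      rw [Nat.card_eq_fintype_card (α := A)] at card_V ⊢
      rw [sum_card_mul_pow_mul_pow, ← card_V,
        ← mul_pow_sub_one (Fintype.card_ne_zero (α := A)) (Nat.card V)]
      ring

lemma isSpanningTree_iff_acyclic {n : ℕ} (t : Fin n → Fin (n + 1)) :
    IsSpanningTree t ↔ Acyclic Fin.succ t := by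
  constructor
  · intro h
    have acc_of : ∀ k (i : Fin n), (step t)^[k] i.succ = 0 →
        Acc (fun a' a => t a = Fin.succ a') i := by
      intro k
      induction k with
      | zero => exact fun i hi => absurd hi (Fin.succ_ne_zero i)
      | succ k ih =>
        refine fun i hi => ⟨_, fun j hj => ih j ?_⟩
        rw [Function.iterate_succ_apply] at hi
        simpa [step, hj] using hi
    exact ⟨fun i => (h i.succ).elim fun k hk => acc_of k i hk⟩
  · intro h v
    have reach : ∀ i : Fin n, ∃ k, (step t)^[k] i.succ = 0 := fun i => by
      induction i using h.induction with
      | _ i ih =>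
        rcases Fin.eq_zero_or_eq_succ (t i) with h0 | ⟨j, hj⟩
        · exact ⟨1, by simpa [step] using h0⟩
        · obtain ⟨k, hk⟩ := ih j hj
          exact ⟨k + 1, by rw [Function.iterate_succ_apply]; simpa [step, hj] using hk⟩
    cases v using Fin.cases with
    | zero => exact ⟨0, rfl⟩
    | succ i => exact reach i

/-- Dependency trees with root word `r` correspond to the trees on the words rooted at `r`. -/
lemma card_isDepTree_root {n : ℕ} (r : Fin n) :
    n * Nat.card {t : Fin n → Fin (n + 1) // IsSpanningTree t ∧ ∀ i, t i = 0 ↔ i = r} =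
      n ^ (n - 1) := by
  have card_eq := card_acyclic_fiber (Fin.succ_injective n) {r}
  have card_rooted := card_acyclic (ι := (Subtype.val : {a // a ∉ ({r} : Finset (Fin n))} → Fin n))
    Subtype.val_injective
  have prop_iff : ∀ t : Fin n → Fin (n + 1), (Acyclic Fin.succ t ∧
      ∀ a, t a ∈ Set.range Fin.succ ↔ a ∉ ({r} : Finset (Fin n))) ↔
        IsSpanningTree t ∧ ∀ i, t i = 0 ↔ i = r := fun t => by
    rw [isSpanningTree_iff_acyclic]
    simp [Fin.range_succ, not_iff_not]
  simp only [prop_iff] at card_eq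
  have card_root : Nat.card {v // v ∉ Set.range (Fin.succ : Fin n → Fin (n + 1))} = 1 := by
    simp [Fin.range_succ]
  have card_base : Nat.card {v // v ∉ Set.range
      (Subtype.val : {a // a ∉ ({r} : Finset (Fin n))} → Fin n)} = 1 := by
    simp
  have card_nonroot : Nat.card {a // a ∉ ({r} : Finset (Fin n))} = n - 1 := by
    simp [Nat.card_eq_fintype_card, Fintype.card_subtype_compl]
  rw [card_root, one_pow, one_mul] at card_eq
  rw [card_base, card_nonroot, one_mul, Nat.card_fin] at card_rooted
  rw [card_eq, card_rooted]

/-- **Counting single-root dependency trees.** The number of dependency trees over `n`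
words, i.e. spanning trees in which exactly one word has head ROOT, is `|D| = n^(n−1)`. -/
theorem card_dependency_trees {n : ℕ} (hn : 1 ≤ n) :
    (univ.filter (fun t : Fin n → Fin (n + 1) => IsDepTree t)).card =
      n ^ (n - 1) := by
  refine Nat.eq_of_mul_eq_mul_left hn ?_
  have card_eq : #(univ.filter fun t : Fin n → Fin (n + 1) => IsDepTree t) =
      ∑ r, Nat.card {t : Fin n → Fin (n + 1) // IsSpanningTree t ∧ ∀ i, t i = 0 ↔ i = r} := by
    rw [← Nat.card_sigma, ← Fintype.card_subtype, ← Nat.card_eq_fintype_card]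
    refine (Nat.card_congr (Equiv.ofBijective (fun x => ⟨x.2.1, x.2.2.1, x.1,
      (x.2.2.2 _).2 rfl, fun i hi => (x.2.2.2 i).1 hi⟩) ⟨?_, ?_⟩)).symm
    · rintro ⟨r, t, ht, hr⟩ ⟨r', t', ht', hr'⟩ heq
      obtain rfl : t = t' := congrArg Subtype.val heq
      obtain rfl : r = r' := (hr' r).1 ((hr r).2 rfl)
      rfl
    · rintro ⟨t, ht, r, hr, huniq⟩
      exact ⟨⟨r, t, ht, fun i => ⟨huniq i, fun h => h ▸ hr⟩⟩, rfl⟩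
  rw [card_eq, Finset.mul_sum]
  simp only [card_isDepTree_root, Finset.sum_const, Finset.card_univ, Fintype.card_fin,
    smul_eq_mul]

end
end

section
/- Fix n ≥ 1 and edge weights φ with Z_D > 0, and suppose φ(0 → r) > 0 and m(r) := Σ_{t' ∈ D, t'(r) = 0} φ(t') > 0 for every word r ∈ Fin n, with R := Σ_{r ∈ Fin n} φ(0 → r). Define the WilsonRC sampling probability of a dependency tree t ∈ D with root word r (i.e. t(r) = 0) as w(t) = (φ(0 → r)/R) · (φ(t)/m(r)). Then w(t) = p(t) = φ(t)/Z_D holds for every t ∈ D if and only if for every word r ∈ Fin n, φ(0 → r) · Z_D = R · m(r); equivalently, if and only if for every pair of words r₁, r₂, φ(0 → r₁) · m(r₂) = φ(0 → r₂) · m(r₁), i.e. the ROOT edge weights are exactly proportional to the ROOT edge marginals. (Formal characterization of when WilsonRC is unbiased.) -/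
open Finset
open scoped Classical

noncomputable section

/-- The root masses add up to the partition function over dependency trees. -/
theorem sum_rootMass {n : ℕ} (φ : Fin (n + 1) → Fin n → ℝ) :
    ∑ r : Fin n, rootMass φ r = ZD φ := by
  simp only [rootMass, ZD, sum_filter]
  rw [sum_comm]
  refine sum_congr rfl fun t _ => ?_
  by_cases ht : IsDepTree t
  · obtain ⟨i, hi, huniq⟩ := ht.2
    rw [sum_eq_single i]
    · rw [if_pos ⟨ht, hi⟩, if_pos ht]
    · exact fun j _ hj => if_neg fun h => hj (huniq j h.2)
    · simp
  · simp [ht]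

/-- A nonzero root mass is witnessed by a dependency tree of nonzero weight. -/
theorem exists_isDepTree_of_rootMass_ne_zero {n : ℕ} {φ : Fin (n + 1) → Fin n → ℝ} {r : Fin n}
    (h : rootMass φ r ≠ 0) :
    ∃ t : Fin n → Fin (n + 1), IsDepTree t ∧ t r = 0 ∧ treeWeight φ t ≠ 0 := by
  obtain ⟨t, ht, hw⟩ := exists_ne_zero_of_sum_ne_zero h
  obtain ⟨hd, hr⟩ := (mem_filter.mp ht).2
  exact ⟨t, hd, hr, hw⟩

/-- **Characterization of when WilsonRC is unbiased.** Assuming all ROOT edge weights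
and root masses are positive, WilsonRC's sampling probability
`w(t) = (φ(0→r)/R)·(φ(t)/m(r))` equals `p(t) = φ(t)/Z_D` for every dependency tree `t`
iff `φ(0→r)·Z_D = R·m(r)` for every word `r`, iff the ROOT edge weights are exactly
proportional to the ROOT edge marginals: `φ(0→r₁)·m(r₂) = φ(0→r₂)·m(r₁)` for all
`r₁, r₂`. -/
theorem wilsonRC_unbiased_iff {n : ℕ} (hn : 1 ≤ n)
    (φ : Fin (n + 1) → Fin n → ℝ) (hφ : ∀ j i, 0 ≤ φ j i)
    (hZD : 0 < ZD φ)
    (hroot : ∀ r : Fin n, 0 < φ 0 r)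
    (hmass : ∀ r : Fin n, 0 < rootMass φ r) :
    ((∀ t : Fin n → Fin (n + 1), IsDepTree t → ∀ r : Fin n, t r = 0 →
        (φ 0 r / ∑ r' : Fin n, φ 0 r') * (treeWeight φ t / rootMass φ r) =
          treeWeight φ t / ZD φ) ↔
      (∀ r : Fin n, φ 0 r * ZD φ = (∑ r' : Fin n, φ 0 r') * rootMass φ r)) ∧
    ((∀ r : Fin n, φ 0 r * ZD φ = (∑ r' : Fin n, φ 0 r') * rootMass φ r) ↔
      (∀ r₁ r₂ : Fin n, φ 0 r₁ * rootMass φ r₂ = φ 0 r₂ * rootMass φ r₁)) := by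
  have hR : 0 < ∑ r' : Fin n, φ 0 r' :=
    sum_pos (fun r _ => hroot r) ⟨⟨0, hn⟩, mem_univ _⟩
  refine ⟨⟨fun h r => ?_, fun h t _ r _ => ?_⟩, fun h r₁ r₂ => ?_, fun h r => ?_⟩
  · obtain ⟨t, hd, hr, hw⟩ := exists_isDepTree_of_rootMass_ne_zero (hmass r).ne'
    have ht := h t hd r hr
    rw [div_mul_div_comm, div_eq_div_iff (mul_pos hR (hmass r)).ne' hZD.ne'] at ht
    apply mul_left_cancel₀ hw
    linear_combination ht
  · rw [div_mul_div_comm, div_eq_div_iff (mul_pos hR (hmass r)).ne' hZD.ne']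
    linear_combination treeWeight φ t * h r
  · apply mul_left_cancel₀ hR.ne'
    linear_combination φ 0 r₂ * h r₁ - φ 0 r₁ * h r₂
  · rw [← sum_rootMass, mul_sum, sum_mul]
    exact sum_congr rfl fun r' _ => h r r'

end
end

section
/- WilsonRC is a biased sampler in general: there exist an integer n ≥ 1 and strictly positive edge weights φ such that Z_D > 0 and the WilsonRC sampling probability w(t) = (φ(0 → r_t)/R) · (φ(t)/m(r_t)) differs from p(t) = φ(t)/Z_D for some dependency tree t ∈ D. In particular, for n = 3 with all edge weights equal to 1, the graph restricted to the edges of Figure 1 has exactly three dependency trees of equal weight, yet WilsonRC assigns them probabilities 1/4, 1/4 and 1/2 rather than 1/3 each. -/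
open Finset
open scoped Classical

noncomputable section

/-- The WilsonRC sampling probability of a dependency tree `t` with root word `r`:
first the ROOT edge `0 → r` is sampled proportionally to its weight, then the rest of
the tree proportionally to its weight among dependency trees with that root edge. -/
def wilsonRC {n : ℕ} (φ : Fin (n + 1) → Fin n → ℝ)
    (t : Fin n → Fin (n + 1)) (r : Fin n) : ℝ :=
  (φ 0 r / ∑ r' : Fin n, φ 0 r') * (treeWeight φ t / rootMass φ r)

/-- A fixed point that is eventually reached by iterating a self-map of a finite type is reached
within `Fintype.card α` steps. -/
theorem iterate_card_eq_of_iterate_eq {α : Type*} [Fintype α] {f : α → α} {a x : α}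
    (ha : f a = a) {k : ℕ} (hk : f^[k] x = a) : f^[Fintype.card α] x = a := by
  classical
  have hex : ∃ k, f^[k] x = a := ⟨k, hk⟩
  set m := Nat.find hex
  have hmx : f^[m] x = a := Nat.find_spec hex
  have hne : ∀ i j, i < j → j ≤ m → f^[i] x ≠ f^[j] x := by
    intro i j hij hj h
    refine Nat.find_min hex (m := m - j + i) (by omega) ?_
    rw [Function.iterate_add_apply, h, ← Function.iterate_add_apply, Nat.sub_add_cancel hj, hmx]
  have hinj : Function.Injective fun i : Fin (m + 1) => f^[(i : ℕ)] x := by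
    intro i j h
    rcases lt_trichotomy (i : ℕ) j with hij | hij | hij
    · exact absurd h (hne _ _ hij (by omega))
    · exact Fin.ext hij
    · exact absurd h.symm (hne _ _ hij (by omega))
  have hcard := Fintype.card_le_of_injective _ hinj
  rw [Fintype.card_fin] at hcard
  rw [← Nat.sub_add_cancel (show m ≤ Fintype.card α by omega), Function.iterate_add_apply, hmx]
  exact Function.iterate_fixed ha _

theorem isDepTree_iff {n : ℕ} (t : Fin n → Fin (n + 1)) :
    IsDepTree t ↔ (∀ v, (step t)^[n + 1] v = 0) ∧ ∃ i, t i = 0 ∧ ∀ j, t j = 0 → j = i := by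
  refine and_congr ⟨fun h v => ?_, fun h v => ⟨_, h v⟩⟩ Iff.rfl
  obtain ⟨k, hk⟩ := h v
  simpa using iterate_card_eq_of_iterate_eq (f := step t) (a := 0) rfl hk

theorem treeWeight_natCast {n : ℕ} (w : Fin (n + 1) → Fin n → ℕ) (t : Fin n → Fin (n + 1)) :
    treeWeight (fun j i => (w j i : ℝ)) t = ((∏ i, w (t i) i : ℕ) : ℝ) := by
  simp [treeWeight]

theorem ZD_natCast {n : ℕ} (w : Fin (n + 1) → Fin n → ℕ) :
    ZD (fun j i => (w j i : ℝ)) =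
      ((∑ t : Fin n → Fin (n + 1) with (∀ v, (step t)^[n + 1] v = 0) ∧
        ∃ i, t i = 0 ∧ ∀ j, t j = 0 → j = i, ∏ i, w (t i) i : ℕ) : ℝ) := by
  rw [ZD, Nat.cast_sum]
  exact Finset.sum_congr (Finset.filter_congr fun t _ => isDepTree_iff t)
    fun t _ => treeWeight_natCast w t

theorem rootMass_natCast {n : ℕ} (w : Fin (n + 1) → Fin n → ℕ) (r : Fin n) :
    rootMass (fun j i => (w j i : ℝ)) r =
      ((∑ t : Fin n → Fin (n + 1) with ((∀ v, (step t)^[n + 1] v = 0) ∧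
        ∃ i, t i = 0 ∧ ∀ j, t j = 0 → j = i) ∧ t r = 0, ∏ i, w (t i) i : ℕ) : ℝ) := by
  rw [rootMass, Nat.cast_sum]
  exact Finset.sum_congr (Finset.filter_congr fun t _ => and_congr_left' (isDepTree_iff t))
    fun t _ => treeWeight_natCast w t

/-- Weights on two words, where only the edge from the first to the second word has weight `2`. -/
def biasedWeights : Fin 3 → Fin 2 → ℕ := ![![1, 1], ![1, 2], ![1, 1]]

/-- The edge indicator of a graph on three words with two trees rooted at the first word and one
tree rooted at the second. -/
def figureEdges : Fin 4 → Fin 3 → ℕ := ![![1, 1, 0], ![0, 1, 1], ![0, 0, 1], ![1, 0, 0]]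

theorem ZD_biasedWeights : ZD (fun j i => (biasedWeights j i : ℝ)) = 3 := by
  rw [ZD_natCast]
  exact_mod_cast (by decide +kernel)

theorem rootMass_biasedWeights : rootMass (fun j i => (biasedWeights j i : ℝ)) 0 = 2 := by
  rw [rootMass_natCast]
  exact_mod_cast (by decide +kernel)

theorem rootMass_figureEdges_zero : rootMass (fun j i => (figureEdges j i : ℝ)) 0 = 2 := by
  rw [rootMass_natCast]
  exact_mod_cast (by decide +kernel)

theorem rootMass_figureEdges_one : rootMass (fun j i => (figureEdges j i : ℝ)) 1 = 1 := by
  rw [rootMass_natCast]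
  exact_mod_cast (by decide +kernel)

theorem wilsonRC_figureEdges {t : Fin 3 → Fin 4} {r : Fin 3} (hr : figureEdges 0 r = 1)
    (ht : ∏ i, figureEdges (t i) i = 1) :
    wilsonRC (fun j i => (figureEdges j i : ℝ)) t r =
      1 / 2 * (1 / rootMass (fun j i => (figureEdges j i : ℝ)) r) := by
  have hsum : ∑ r', figureEdges 0 r' = 2 := by decide
  rw [wilsonRC, treeWeight_natCast, ht, ← Nat.cast_sum, hsum, hr, Nat.cast_one, Nat.cast_ofNat]

theorem eq_of_isDepTree_of_figureEdges_prod_pos (t : Fin 3 → Fin 4) (ht : IsDepTree t)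
    (hpos : 0 < ∏ i, figureEdges (t i) i) : t = ![0, 1, 1] ∨ t = ![0, 1, 2] ∨ t = ![3, 0, 2] := by
  rw [isDepTree_iff] at ht
  revert t
  decide +kernel

/-- **WilsonRC is a biased sampler in general.** There exist `n ≥ 1` and strictly
positive edge weights `φ` with `Z_D > 0` such that the WilsonRC sampling probability
differs from `p(t) = φ(t)/Z_D` on some dependency tree `t`. Moreover (Figure 1), for
`n = 3` there is a graph with 0/1 edge weights having exactly three dependency trees of
weight 1, to which WilsonRC assigns probabilities 1/4, 1/4 and 1/2 rather than 1/3. -/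
theorem wilsonRC_biased :
    (∃ (n : ℕ), 1 ≤ n ∧ ∃ φ : Fin (n + 1) → Fin n → ℝ,
      (∀ j i, 0 < φ j i) ∧ 0 < ZD φ ∧
      ∃ (t : Fin n → Fin (n + 1)) (r : Fin n), IsDepTree t ∧ t r = 0 ∧
        wilsonRC φ t r ≠ treeWeight φ t / ZD φ) ∧
    (∃ φ : Fin 4 → Fin 3 → ℝ, (∀ j i, φ j i = 0 ∨ φ j i = 1) ∧
      ∃ (t₁ t₂ t₃ : Fin 3 → Fin 4) (r₁ r₂ r₃ : Fin 3),
        t₁ ≠ t₂ ∧ t₁ ≠ t₃ ∧ t₂ ≠ t₃ ∧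
        IsDepTree t₁ ∧ IsDepTree t₂ ∧ IsDepTree t₃ ∧
        t₁ r₁ = 0 ∧ t₂ r₂ = 0 ∧ t₃ r₃ = 0 ∧
        treeWeight φ t₁ = 1 ∧ treeWeight φ t₂ = 1 ∧ treeWeight φ t₃ = 1 ∧
        (∀ t : Fin 3 → Fin 4, IsDepTree t → 0 < treeWeight φ t →
          t = t₁ ∨ t = t₂ ∨ t = t₃) ∧
        wilsonRC φ t₁ r₁ = 1 / 4 ∧ wilsonRC φ t₂ r₂ = 1 / 4 ∧
        wilsonRC φ t₃ r₃ = 1 / 2) := by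
  constructor
  · refine ⟨2, by norm_num, fun j i => (biasedWeights j i : ℝ), fun j i => ?_, ?_,
      ![0, 1], 0, ?_, rfl, ?_⟩
    · exact Nat.cast_pos.mpr (by decide +revert)
    · rw [ZD_biasedWeights]
      norm_num
    · rw [isDepTree_iff]
      decide +kernel
    · rw [wilsonRC, ZD_biasedWeights, rootMass_biasedWeights, treeWeight_natCast]
      norm_num [biasedWeights, Fin.sum_univ_two, Fin.prod_univ_two]
  · refine ⟨fun j i => (figureEdges j i : ℝ), fun j i => ?_, ![0, 1, 1], ![0, 1, 2], ![3, 0, 2],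
      0, 0, 1, by decide, by decide, by decide, ?_, ?_, ?_, rfl, rfl, rfl, ?_, ?_, ?_,
      fun t ht hpos => ?_, ?_, ?_, ?_⟩
    · have h : figureEdges j i = 0 ∨ figureEdges j i = 1 := by decide +revert
      exact h.imp Nat.cast_eq_zero.mpr Nat.cast_eq_one.mpr
    iterate 3
      · rw [isDepTree_iff]
        decide +kernel
    iterate 3
      · rw [treeWeight_natCast]
        exact_mod_cast (by decide +kernel)
    · rw [treeWeight_natCast] at hpos
      exact eq_of_isDepTree_of_figureEdges_prod_pos t ht (by exact_mod_cast hpos)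
    iterate 2
      · rw [wilsonRC_figureEdges (by decide) (by decide), rootMass_figureEdges_zero]
        norm_num
    · rw [wilsonRC_figureEdges (by decide) (by decide), rootMass_figureEdges_one]
      norm_num

end
end
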